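/- There is no 14 × 15 binary 3-covering array; equivalently, CAN(3,15,2) ≥ 15, i.e., every m × 15 binary 3-covering array has m ≥ 15. -/

import Mathlib

/-- An `m × n` matrix over `B_q = {0,…,q-1}` is a `t`-covering array if for any `t`
distinct column indices and any `q`-ary vector of length `t`, some row realizes it. -/
def IsCoveringArray (m n q t : ℕ) (C : Fin m → Fin n → Fin q) : Prop :=
  ∀ cols : Fin t → Fin n, Function.Injective cols →
    ∀ v : Fin t → Fin q, ∃ r : Fin m, ∀ j : Fin t, C r (cols j) = v j

/-- `CAN t n q` : the minimal size `m` for which a `CA(m; t, n, q)` exists. -/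
noncomputable def CAN (t n q : ℕ) : ℕ :=
  sInf { m | ∃ C : Fin m → Fin n → Fin q, IsCoveringArray m n q t C }

/-- The weight of the `i`-th column: the number of nonzero entries. -/
def colWt {m n q : ℕ} (C : Fin m → Fin n → Fin q) (i : Fin n) : ℕ :=
  (Finset.univ.filter fun r : Fin m => (C r i : ℕ) ≠ 0).card

/-- The support of the `i`-th column: the set of coordinates where it is nonzero. -/
def colSupp {m n q : ℕ} (C : Fin m → Fin n → Fin q) (i : Fin n) : Finset (Fin m) :=
  Finset.univ.filter fun r : Fin m => (C r i : ℕ) ≠ 0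

/-- The Hamming distance between the `i`-th and `j`-th columns. -/
def colDist {m n q : ℕ} (C : Fin m → Fin n → Fin q) (i j : Fin n) : ℕ :=
  (Finset.univ.filter fun r : Fin m => C r i ≠ C r j).card

/-- Two arrays are equivalent if one is obtained from the other by a row permutation,
a column permutation, and value permutations applied columnwise. -/
def CAEquiv {m n q : ℕ} (C C' : Fin m → Fin n → Fin q) : Prop :=
  ∃ (σ : Equiv.Perm (Fin m)) (τ : Equiv.Perm (Fin n)) (f : Fin n → Equiv.Perm (Fin q)),
    ∀ r i, C' r i = f i (C (σ r) (τ i))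

/-- The standard maximal binary 2-covering array of size `m` : an
`m × (m-1).choose (m/2 - 1)` binary matrix whose first row is all ones and whose columns,
restricted to the remaining `m - 1` rows, are exactly (i.e. are pairwise distinct) the binary
vectors of length `m-1` with `m/2 - 1` ones. -/
def IsStandardMaxArray (m : ℕ) (S : Fin m → Fin ((m-1).choose (m/2 - 1)) → Fin 2) : Prop :=
  (∀ (r : Fin m) (i), (r : ℕ) = 0 → S r i = 1) ∧
  (Function.Injective fun i => fun r => S r i) ∧
  (∀ i, (Finset.univ.filter fun r : Fin m => (r : ℕ) ≠ 0 ∧ S r i = 1).card = m/2 - 1)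

/-- Two binary vectors are qualitatively independent if each of the four pairs of values
occurs at some coordinate. -/
def QualIndep {R : Type*} (x y : R → Bool) : Prop :=
  ∀ a b : Bool, ∃ r, x r = a ∧ y r = b

instance {R : Type*} [Fintype R] (x y : R → Bool) : Decidable (QualIndep x y) :=
  inferInstanceAs (Decidable (∀ a b : Bool, ∃ r, x r = a ∧ y r = b))

/-- Equality of binary vectors up to complementation. -/
def EqUpToCompl {R : Type*} (x y : R → Bool) : Prop :=
  (∀ r, x r = y r) ∨ ∀ r, x r = !y r

instance {R : Type*} [Fintype R] (x y : R → Bool) : Decidable (EqUpToCompl x y) :=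
  inferInstanceAs (Decidable ((∀ r, x r = y r) ∨ ∀ r, x r = !y r))

/-- The characteristic vector of a list of coordinates. -/
def charVec {n : ℕ} (s : List (Fin n)) (r : Fin n) : Bool := decide (r ∈ s)

/-- The binary expansion of `u`, as a vector of length `n`. -/
def bitVec (n u : ℕ) (r : Fin n) : Bool := u.testBit r

theorem forall_of_forall_bitVec {n : ℕ} {P : (Fin n → Bool) → Prop}
    (h : ∀ u : Fin (2 ^ n), P (bitVec n u)) (x : Fin n → Bool) : P x := by
  have hx : bitVec n (Nat.ofBits x) = x := by
    funext i
    simp [bitVec]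
  have := h ⟨Nat.ofBits x, Nat.ofBits_lt_two_pow x⟩
  rwa [hx] at this

namespace QualIndep

variable {R S : Type*} {x y z : R → Bool}

theorem symm (h : QualIndep x y) : QualIndep y x := fun a b =>
  let ⟨r, h₁, h₂⟩ := h b a
  ⟨r, h₂, h₁⟩

theorem comp (h : QualIndep x y) {f : S → R} (hf : Function.Surjective f) :
    QualIndep (x ∘ f) (y ∘ f) := fun a b => by
  obtain ⟨r, h₁, h₂⟩ := h a b
  obtain ⟨s, rfl⟩ := hf r
  exact ⟨s, h₁, h₂⟩

theorem congr_left (h : QualIndep x y) (hz : EqUpToCompl x z) : QualIndep z y := fun a b => by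
  rcases hz with hz | hz
  · obtain ⟨r, h₁, h₂⟩ := h a b
    exact ⟨r, by rw [← hz, h₁], h₂⟩
  · obtain ⟨r, h₁, h₂⟩ := h (!a) b
    exact ⟨r, by simpa [hz] using h₁, h₂⟩

theorem congr_right (h : QualIndep x y) (hz : EqUpToCompl y z) : QualIndep x z :=
  (h.symm.congr_left hz).symm

end QualIndep

/-- A family of pairwise qualitatively independent vectors covered by a list of sets of
pairwise dependent vectors has at most as many members as the list. -/
theorem card_le_length_of_cover {n : ℕ} {ι : Type*} (s : Finset ι) (x : ι → Fin n → Bool)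
    (hx : ∀ i ∈ s, ∀ j ∈ s, i ≠ j → QualIndep (x i) (x j)) (L : List (List (List (Fin n))))
    (hL : ∀ l ∈ L, ∀ a ∈ l, ∀ b ∈ l, ¬ QualIndep (charVec a) (charVec b))
    (hc : ∀ i ∈ s, ∃ l ∈ L, ∃ a ∈ l, EqUpToCompl (x i) (charVec a)) :
    s.card ≤ L.length := by
  have hc' : ∀ i ∈ s, ∃ k : Fin L.length, ∃ a ∈ L[k], EqUpToCompl (x i) (charVec a) := by
    intro i hi
    obtain ⟨l, hl, h⟩ := hc i hi
    obtain ⟨k, hk, rfl⟩ := List.getElem_of_mem hl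
    exact ⟨⟨k, hk⟩, h⟩
  rcases s.eq_empty_or_nonempty with rfl | ⟨i₀, hi₀⟩
  · simp
  have : Nonempty (Fin L.length) := ⟨(hc' i₀ hi₀).choose⟩
  choose! κ hκ using hc'
  by_contra! hlt
  obtain ⟨i, hi, j, hj, hij, he⟩ := Finset.exists_ne_map_eq_of_card_lt_of_maps_to
    (s := s) (t := (Finset.univ : Finset (Fin L.length))) (by simpa using hlt)
    (f := κ) (fun _ _ => by simp)
  obtain ⟨a, ha, hxa⟩ := hκ i hi
  obtain ⟨b, hb, hxb⟩ := hκ j hj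
  rw [← he] at hb
  exact hL _ (List.getElem_mem _) a ha b hb
    (((hx i hi j hj hij).congr_left hxa).congr_right hxb)

/-- A partition of the sets of size one, two and three on six points, up to complementation,
into ten cliques of dependent sets. -/
def sixCover : List (List (List (Fin 6))) :=
  [[[5], [0], [5, 0], [5, 0, 1], [2, 3]], [[1], [5, 1], [5, 1, 2], [3, 4]],
   [[2], [5, 2], [5, 2, 3], [4, 0]], [[3], [5, 3], [5, 3, 4], [0, 1]],
   [[4], [5, 4], [5, 4, 0], [1, 2]],
   [[5, 0, 2], [1, 3]], [[5, 1, 3], [2, 4]], [[5, 2, 4], [3, 0]], [[5, 3, 0], [4, 1]],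
   [[5, 4, 1], [0, 2]]]

theorem sixCover_dependent :
    ∀ l ∈ sixCover, ∀ a ∈ l, ∀ b ∈ l, ¬ QualIndep (charVec a) (charVec b) := by
  decide +kernel

theorem exists_mem_sixCover (x : Fin 6 → Bool) : (∃ r, x r = true) → (∃ r, x r = false) →
    ∃ l ∈ sixCover, ∃ a ∈ l, EqUpToCompl x (charVec a) := by
  revert x
  exact forall_of_forall_bitVec (by decide +kernel)

/-- A partition of the sets independent of `{0, 1}` on seven points, up to complementation,
into ten cliques of dependent sets. -/
def pairCover : List (List (List (Fin 7))) :=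
  [[[0, 2], [0, 2, 3], [1, 4], [1, 4, 5]], [[0, 3], [0, 3, 4], [1, 5], [1, 5, 6]],
   [[0, 4], [0, 4, 5], [1, 6], [1, 6, 2]], [[0, 5], [0, 5, 6], [1, 2], [1, 2, 3]],
   [[0, 6], [0, 6, 2], [1, 3], [1, 3, 4]],
   [[0, 2, 4], [1, 3, 5]], [[0, 3, 5], [1, 4, 6]], [[0, 4, 6], [1, 5, 2]],
   [[0, 5, 2], [1, 6, 3]], [[0, 6, 3], [1, 2, 4]]]

theorem pairCover_dependent :
    ∀ l ∈ pairCover, ∀ a ∈ l, ∀ b ∈ l, ¬ QualIndep (charVec a) (charVec b) := by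
  decide +kernel

theorem exists_mem_pairCover (x : Fin 7 → Bool) : QualIndep (charVec [0, 1]) x →
    ∃ l ∈ pairCover, ∃ a ∈ l, EqUpToCompl x (charVec a) := by
  revert x
  exact forall_of_forall_bitVec (by decide +kernel)

/-- The six ways of splitting `{3, 4, 5, 6}` into an ordered pair of two-element sets;
splittings `j` and `j + 3` are opposite. -/
def splitting : Fin 6 → Fin 4 → Fin 7 :=
  ![![3, 4, 5, 6], ![3, 5, 4, 6], ![3, 6, 4, 5], ![5, 6, 3, 4], ![4, 6, 3, 5], ![4, 5, 3, 6]]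

/-- The triple consisting of a point of `{0, 1, 2}` and the first part of a splitting of
`{3, 4, 5, 6}`. -/
def mixedTriple (a : Fin 3) (j : Fin 6) : List (Fin 7) :=
  [a.castLE (by decide), splitting j 0, splitting j 1]

/-- Pairs of dependent triples covering every set that is independent of `{0, 1, 2}` and of
all `mixedTriple a j`. -/
def tripleCover (j : Fin 6) : List (List (List (Fin 7))) :=
  [(0, 1, 2), (1, 2, 0), (2, 0, 1)].flatMap fun (a, b, c) =>
    [[[a, b, splitting j 0], [c, splitting j 1, splitting j 3]],
     [[a, b, splitting j 1], [c, splitting j 0, splitting j 2]],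
     [[a, splitting j 1, splitting j 2], [b, splitting j 0, splitting j 3]]]

theorem tripleCover_dependent (j : Fin 6) :
    ∀ l ∈ tripleCover j, ∀ a ∈ l, ∀ b ∈ l, ¬ QualIndep (charVec a) (charVec b) := by
  revert j
  decide +kernel

theorem exists_mem_tripleCover (x : Fin 7 → Bool) : QualIndep (charVec [0, 1, 2]) x →
    ∀ j, (∀ a, QualIndep (charVec (mixedTriple a j)) x) →
    ∃ l ∈ tripleCover j, ∃ a ∈ l, EqUpToCompl x (charVec a) := by
  revert x
  exact forall_of_forall_bitVec (by decide +kernel)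

/-- The number of coordinates at which two binary vectors differ. -/
def vecDist {R : Type*} [Fintype R] (x y : R → Bool) : ℕ :=
  (Finset.univ.filter fun r => x r ≠ y r).card

/-- The number of ones of a binary vector. -/
def vecWt {R : Type*} [Fintype R] (x : R → Bool) : ℕ :=
  (Finset.univ.filter fun r => x r = true).card

theorem exists_mixedTriple (x : Fin 7 → Bool) : QualIndep (charVec [0, 1, 2]) x →
    (vecWt x = 3 ∨ vecWt x = 4) →
    ¬ (vecDist (charVec [0, 1, 2]) x = 2 ∨ vecDist (charVec [0, 1, 2]) x = 5) →
    ∃ a j, EqUpToCompl x (charVec (mixedTriple a j)) := by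
  unfold vecWt vecDist
  revert x
  exact forall_of_forall_bitVec (by decide +kernel)

theorem mixedTriple_independent : ∀ (j j' : Fin 6) (a a' : Fin 3),
    j.val % 3 = j'.val % 3 →
    QualIndep (charVec (mixedTriple a j)) (charVec (mixedTriple a' j')) →
    (j = j' ∧ a ≠ a') ∨ (j ≠ j' ∧ a = a') := by
  decide +kernel

theorem vecWt_comp {R S : Type*} [Fintype R] [Fintype S] (e : S ≃ R) (x : R → Bool) :
    vecWt (x ∘ e) = vecWt x :=
  Finset.card_equiv e (by simp)

theorem vecDist_comp {R S : Type*} [Fintype R] [Fintype S] (e : S ≃ R) (x y : R → Bool) :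
    vecDist (x ∘ e) (y ∘ e) = vecDist x y :=
  Finset.card_equiv e (by simp)

theorem vecWt_compl_add {R : Type*} [Fintype R] (x : R → Bool) :
    vecWt (fun r => !x r) + vecWt x = Fintype.card R := by
  have := Finset.card_filter_add_card_filter_not (s := Finset.univ) (fun r : R => x r = true)
  simp only [Bool.not_eq_true, Finset.card_univ] at this
  simp only [vecWt, Bool.not_eq_true']
  omega

theorem vecDist_compl_add {R : Type*} [Fintype R] (x y : R → Bool) :
    vecDist (fun r => !x r) y + vecDist x y = Fintype.card R := by
  have := Finset.card_filter_add_card_filter_not (s := Finset.univ) (fun r : R => x r = y r)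
  simp only [Finset.card_univ] at this
  simp only [vecDist, ne_eq, Bool.not_eq, not_not]
  omega

/-- After relabelling, a binary vector is the characteristic vector of an initial segment. -/
theorem exists_equiv_comp_eq {R : Type*} [Fintype R] {n : ℕ} (hR : Fintype.card R = n)
    (d : R → Bool) : ∃ e : Fin n ≃ R, ∀ r, (d ∘ e) r = decide (r.val < vecWt d) := by
  obtain ⟨e₀⟩ : Nonempty (Fin n ≃ R) := ⟨(Fintype.equivFinOfCardEq hR).symm⟩
  have hle : vecWt d ≤ n := by
    rw [← hR]
    exact Finset.card_le_univ _
  have hcard : Fintype.card {r : Fin n // r.val < vecWt d} =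
      Fintype.card {r : Fin n // d (e₀ r) = true} := by
    rw [Fintype.card_subtype, Fintype.card_subtype]
    have : (Finset.univ.filter fun r => d (e₀ r) = true).card = vecWt d := vecWt_comp e₀ d
    rw [this]
    have h := Fin.card_filter_val_lt (n := n) (m := vecWt d)
    simpa [hle] using h
  let f := Fintype.equivOfCardEq hcard
  refine ⟨f.extendSubtype.trans e₀, fun r => ?_⟩
  by_cases hr : r.val < vecWt d
  · simpa [hr] using f.extendSubtype_mem r hr
  · simpa [hr] using f.extendSubtype_not_mem r hr

/-- Pairwise qualitatively independent vectors of length at most six number at most ten. -/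
theorem seven_le_card {R ι : Type*} [Fintype R] [Fintype ι] (x : ι → R → Bool)
    (hx : Pairwise fun i j => QualIndep (x i) (x j)) (hι : 10 < Fintype.card ι) :
    7 ≤ Fintype.card R := by
  by_contra! hR
  have hne : ∀ i : ι, ∃ j, i ≠ j := by
    have : Nontrivial ι := Fintype.one_lt_card_iff_nontrivial.mp (by omega)
    exact fun i => (exists_ne i).imp fun _ => Ne.symm
  obtain ⟨i₀⟩ : Nonempty ι := Fintype.card_pos_iff.mp (by omega)
  obtain ⟨j₀, h₀⟩ := hne i₀
  obtain ⟨r₀, -, -⟩ := hx h₀ true true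
  have : Nonempty R := ⟨r₀⟩
  obtain ⟨g⟩ := Function.Embedding.nonempty_of_card_le
    (show Fintype.card R ≤ Fintype.card (Fin 6) by simp; omega)
  have hf : Function.Surjective (Function.invFun g) := Function.invFun_surjective g.injective
  have := card_le_length_of_cover Finset.univ (fun i => x i ∘ Function.invFun g)
    (fun i _ j _ hij => (hx hij).comp hf) sixCover sixCover_dependent fun i _ => by
      obtain ⟨j, hij⟩ := hne i
      have h := (hx hij).comp hf
      exact exists_mem_sixCover _ ((h true true).imp fun _ => And.left)
        ((h false true).imp fun _ => And.left)
  simp only [Finset.card_univ, sixCover, List.length_cons, List.length_nil] at this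
  omega

theorem three_le_vecWt {R ι : Type*} [Fintype R] [Fintype ι] (hR : Fintype.card R = 7)
    (d : R → Bool) (x : ι → R → Bool) (hd : ∀ i, QualIndep d (x i))
    (hx : Pairwise fun i j => QualIndep (x i) (x j)) (hι : 10 < Fintype.card ι) :
    3 ≤ vecWt d := by
  by_contra! hlt
  obtain ⟨e, he⟩ := exists_equiv_comp_eq hR d
  obtain ⟨i₀⟩ : Nonempty ι := Fintype.card_pos_iff.mp (by omega)
  have htwo : vecWt d = 2 := by
    obtain ⟨r, hr, hxr⟩ := (hd i₀).comp e.surjective true true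
    obtain ⟨s, hs, hxs⟩ := (hd i₀).comp e.surjective true false
    have hrs : r ≠ s := by
      rintro rfl
      simp_all
    rw [he, decide_eq_true_eq] at hr hs
    omega
  have hde : EqUpToCompl (d ∘ e) (charVec [0, 1]) := by
    refine Or.inl fun r => ?_
    rw [he, htwo]
    revert r
    decide
  have := card_le_length_of_cover Finset.univ (fun i => x i ∘ e)
    (fun i _ j _ hij => (hx hij).comp e.surjective) pairCover pairCover_dependent fun i _ =>
      exists_mem_pairCover _ (((hd i).comp e.surjective).congr_left hde)
  simp only [Finset.card_univ, pairCover, List.length_cons, List.length_nil] at this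
  omega

theorem eqUpToCompl_compl {R : Type*} (x : R → Bool) : EqUpToCompl x fun r => !x r :=
  Or.inr (by simp)

theorem vecWt_eq_three_or_four {R ι : Type*} [Fintype R] [Fintype ι]
    (hR : Fintype.card R = 7) (d : R → Bool) (x : ι → R → Bool) (hd : ∀ i, QualIndep d (x i))
    (hx : Pairwise fun i j => QualIndep (x i) (x j)) (hι : 10 < Fintype.card ι) :
    vecWt d = 3 ∨ vecWt d = 4 := by
  have h₁ := three_le_vecWt hR d x hd hx hι
  have h₂ := three_le_vecWt hR _ x (fun i => (hd i).congr_left (eqUpToCompl_compl d)) hx hι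
  have := vecWt_compl_add d
  omega

theorem seven_le_card_vecDist_charVec {ι : Type*} [Fintype ι] (x : ι → Fin 7 → Bool)
    (hd : ∀ i, QualIndep (charVec [0, 1, 2]) (x i))
    (hx : Pairwise fun i j => QualIndep (x i) (x j)) (hw : ∀ i, vecWt (x i) = 3 ∨ vecWt (x i) = 4)
    (hι : Fintype.card ι = 13) :
    7 ≤ (Finset.univ.filter fun i =>
      vecDist (charVec [0, 1, 2]) (x i) = 2 ∨ vecDist (charVec [0, 1, 2]) (x i) = 5).card := by
  classical
  by_contra! hlt
  have hsum := Finset.card_filter_add_card_filter_not (s := Finset.univ) (fun i =>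
    vecDist (charVec [0, 1, 2]) (x i) = 2 ∨ vecDist (charVec [0, 1, 2]) (x i) = 5)
  rw [Finset.card_univ, hι] at hsum
  set T := Finset.univ.filter fun i =>
    ¬ (vecDist (charVec [0, 1, 2]) (x i) = 2 ∨ vecDist (charVec [0, 1, 2]) (x i) = 5) with hT
  have hmixed : ∀ i ∈ T, ∃ a j, EqUpToCompl (x i) (charVec (mixedTriple a j)) := fun i hi =>
    exists_mixedTriple (x i) (hd i) (hw i) (Finset.mem_filter.mp hi).2
  choose! a j haj using hmixed
  obtain ⟨c, -, hc⟩ := Finset.exists_lt_card_fiber_of_mul_lt_card_of_maps_to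
    (s := T) (t := Finset.range 3) (f := fun i => (j i).val % 3) (n := 2)
    (fun i _ => Finset.mem_range.mpr (Nat.mod_lt _ (by norm_num)))
    (by rw [Finset.card_range]; omega)
  obtain ⟨i₁, i₂, i₃, h₁, h₂, h₃, h₁₂, h₁₃, h₂₃⟩ := Finset.two_lt_card_iff.mp hc
  rw [Finset.mem_filter] at h₁ h₂ h₃
  have hpair : ∀ i i', i ∈ T ∧ (j i).val % 3 = c → i' ∈ T ∧ (j i').val % 3 = c → i ≠ i' →
      (j i = j i' ∧ a i ≠ a i') ∨ (j i ≠ j i' ∧ a i = a i') := fun i i' h h' hne =>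
    mixedTriple_independent _ _ _ _ (h.2.trans h'.2.symm)
      (((hx hne).congr_left (haj i h.1)).congr_right (haj i' h'.1))
  have hall : ∀ b, ∃ i, (i = i₁ ∨ i = i₂ ∨ i = i₃) ∧ i ∈ T ∧ j i = j i₁ ∧ a i = b := by
    have := hpair i₁ i₂ h₁ h₂ h₁₂
    have := hpair i₁ i₃ h₁ h₃ h₁₃
    have := hpair i₂ i₃ h₂ h₃ h₂₃
    intro b
    have : a i₁ = b ∨ a i₂ = b ∨ a i₃ = b := by omega
    rcases this with h | h | h
    · exact ⟨i₁, by simp, h₁.1, rfl, h⟩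
    · exact ⟨i₂, by simp, h₂.1, by omega, h⟩
    · exact ⟨i₃, by simp, h₃.1, by omega, h⟩
  have hcover := card_le_length_of_cover (Finset.univ \ {i₁, i₂, i₃}) x
    (fun _ _ _ _ h => hx h) (tripleCover (j i₁)) (tripleCover_dependent _) fun i hi =>
      exists_mem_tripleCover _ (hd i) _ fun b => by
        obtain ⟨k, hk, hkT, hkj, rfl⟩ := hall b
        have hki : k ≠ i := by
          rintro rfl
          simp [hk] at hi
        have := (hx hki).congr_left (haj k hkT)
        rwa [hkj] at this
  have hthree : ({i₁, i₂, i₃} : Finset ι).card = 3 := Finset.card_eq_three.mpr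
    ⟨i₁, i₂, i₃, h₁₂, h₁₃, h₂₃, rfl⟩
  rw [Finset.card_sdiff_of_subset (Finset.subset_univ _), hthree, Finset.card_univ, hι] at hcover
  simp [tripleCover] at hcover

theorem seven_le_card_vecDist {R ι : Type*} [Fintype R] [Fintype ι] (hR : Fintype.card R = 7)
    (d : R → Bool) (x : ι → R → Bool) (hd : ∀ i, QualIndep d (x i))
    (hx : Pairwise fun i j => QualIndep (x i) (x j)) (hdw : vecWt d = 3 ∨ vecWt d = 4)
    (hw : ∀ i, vecWt (x i) = 3 ∨ vecWt (x i) = 4) (hι : Fintype.card ι = 13) :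
    7 ≤ (Finset.univ.filter fun i => vecDist d (x i) = 2 ∨ vecDist d (x i) = 5).card := by
  wlog hthree : vecWt d = 3 generalizing d
  · have hcompl := vecWt_compl_add d
    have := this (fun r => !d r) (fun i => (hd i).congr_left (eqUpToCompl_compl d))
      (by omega) (by omega)
    refine this.trans (Finset.card_le_card fun i hi => ?_)
    have := vecDist_compl_add d (x i)
    rw [Finset.mem_filter] at hi ⊢
    exact ⟨hi.1, by omega⟩
  obtain ⟨e, he⟩ := exists_equiv_comp_eq hR d
  have hde : d ∘ e = charVec [0, 1, 2] := by
    funext r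
    rw [he, hthree]
    revert r
    decide
  have := seven_le_card_vecDist_charVec (fun i => x i ∘ e)
    (fun i => hde ▸ (hd i).comp e.surjective) (fun _ _ h => (hx h).comp e.surjective)
    (fun i => by simpa only [vecWt_comp] using hw i) hι
  simpa only [← hde, vecDist_comp] using this

/-- The half of the rows of a binary array on which the column `c` takes the value `a`. -/
abbrev Half {m n : ℕ} (B : Fin n → Fin m → Bool) (c : Fin n) (a : Bool) : Type :=
  {r : Fin m // B c r = a}

/-- The restriction of the column `i` to the half given by the column `c` and the value `a`. -/
def restrict {m n : ℕ} (B : Fin n → Fin m → Bool) (c : Fin n) (a : Bool) (i : Fin n) :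
    Half B c a → Bool := fun r => B i r

theorem card_half_add_card_half {m n : ℕ} (B : Fin n → Fin m → Bool) (c : Fin n) :
    Fintype.card (Half B c true) + Fintype.card (Half B c false) = m := by
  have := Finset.card_filter_add_card_filter_not (s := Finset.univ)
    (fun r : Fin m => B c r = true)
  simp only [Bool.not_eq_true, Finset.card_univ, Fintype.card_fin] at this
  rw [Fintype.card_subtype, Fintype.card_subtype, this]

theorem card_filter_half_add {m n : ℕ} (B : Fin n → Fin m → Bool) (c : Fin n)
    (p : Fin m → Prop) [DecidablePred p] :
    (Finset.univ.filter fun r : Half B c true => p r).card +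
      (Finset.univ.filter fun r : Half B c false => p r).card =
      (Finset.univ.filter p).card := by
  have h (a : Bool) : (Finset.univ.filter fun r : Half B c a => p r).card =
      ((Finset.univ.filter p).filter fun r => B c r = a).card := by
    rw [← Fintype.card_subtype, Finset.filter_filter, ← Fintype.card_subtype]
    exact Fintype.card_congr ((Equiv.subtypeSubtypeEquivSubtypeInter _ _).trans
      (Equiv.subtypeEquivRight fun _ => and_comm))
  rw [h, h, ← Finset.card_filter_add_card_filter_not (s := Finset.univ.filter p)
    (fun r => B c r = true)]
  simp only [Bool.not_eq_true]

theorem vecWt_restrict_add {m n : ℕ} (B : Fin n → Fin m → Bool) (c i : Fin n) :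
    vecWt (restrict B c true i) + vecWt (restrict B c false i) = vecWt (B i) :=
  card_filter_half_add B c fun r => B i r = true

theorem vecDist_restrict_add {m n : ℕ} (B : Fin n → Fin m → Bool) (c i j : Fin n) :
    vecDist (restrict B c true i) (restrict B c true j) +
      vecDist (restrict B c false i) (restrict B c false j) = vecDist (B i) (B j) :=
  card_filter_half_add B c fun r => B i r ≠ B j r

theorem vecDist_restrict_self_true_add {m n : ℕ} (B : Fin n → Fin m → Bool) (c i : Fin n) :
    vecDist (restrict B c true c) (restrict B c true i) + vecWt (restrict B c true i) =
      Fintype.card (Half B c true) := by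
  have hc : ∀ r, restrict B c true c r = true := fun r => r.2
  rw [← vecWt_compl_add (restrict B c true i)]
  simp [vecDist, vecWt, hc]

theorem vecDist_restrict_self_false {m n : ℕ} (B : Fin n → Fin m → Bool) (c i : Fin n) :
    vecDist (restrict B c false c) (restrict B c false i) = vecWt (restrict B c false i) := by
  have hc : ∀ r, restrict B c false c r = false := fun r => r.2
  simp [vecDist, vecWt, hc]

/-- A binary array with fifteen columns in which any three distinct columns realize all
patterns has at least fifteen rows. -/
theorem fifteen_le_of_covering {m : ℕ} (B : Fin 15 → Fin m → Bool)
    (hB : ∀ c i j, c ≠ i → c ≠ j → i ≠ j → ∀ a,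
      QualIndep (restrict B c a i) (restrict B c a j)) : 15 ≤ m := by
  by_contra! hm
  have hcard (c : Fin 15) : Fintype.card {i // c ≠ i} = 14 := by
    rw [Fintype.card_subtype, Finset.filter_ne, Finset.card_erase_of_mem (Finset.mem_univ _)]
    simp
  have hge (c a) : 7 ≤ Fintype.card (Half B c a) :=
    seven_le_card (fun i : {i // c ≠ i} => restrict B c a i)
      (fun i j hij => hB c i j i.2 j.2 (Subtype.coe_ne_coe.mpr hij) a) (by rw [hcard]; omega)
  have hseven (c a) : Fintype.card (Half B c a) = 7 := by
    have := card_half_add_card_half B c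
    have := hge c true
    have := hge c false
    cases a <;> omega
  have hcard₂ {c d : Fin 15} (hcd : c ≠ d) : Fintype.card {i // c ≠ i ∧ d ≠ i} = 13 := by
    have : (Finset.univ.filter fun i => c ≠ i ∧ d ≠ i) = {c, d}ᶜ := by
      ext i
      simp [eq_comm]
    rw [Fintype.card_subtype, this, Finset.card_compl, Finset.card_pair hcd, Fintype.card_fin]
  have hindep {c d : Fin 15} (a : Bool) :
      Pairwise fun i j : {i // c ≠ i ∧ d ≠ i} =>
        QualIndep (restrict B c a i) (restrict B c a j) := fun i j hij =>
    hB c i j i.2.1 j.2.1 (Subtype.coe_ne_coe.mpr hij) a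
  have hwt {c d : Fin 15} (hcd : c ≠ d) (a : Bool) :
      vecWt (restrict B c a d) = 3 ∨ vecWt (restrict B c a d) = 4 :=
    vecWt_eq_three_or_four (hseven c a) _ (fun i : {i // c ≠ i ∧ d ≠ i} => restrict B c a i)
      (fun i => hB c d i hcd i.2.1 i.2.2 a) (hindep a) (by rw [hcard₂ hcd]; omega)
  have hcd : (0 : Fin 15) ≠ 1 := by decide
  have hdist (a : Bool) := seven_le_card_vecDist (hseven 0 a) (restrict B 0 a 1)
    (fun i : {i : Fin 15 // 0 ≠ i ∧ 1 ≠ i} => restrict B 0 a i)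
    (fun i => hB 0 1 i hcd i.2.1 i.2.2 a) (hindep a) (hwt hcd a) (fun i => hwt i.2.1 a)
    (hcard₂ hcd)
  obtain ⟨i, hi⟩ := Finset.inter_nonempty_of_card_lt_card_add_card
    (Finset.subset_univ _) (Finset.subset_univ _)
    ((by rw [Finset.card_univ, hcard₂ hcd]; norm_num : _ < 7 + 7).trans_le
      (add_le_add (hdist true) (hdist false)))
  simp only [Finset.mem_inter, Finset.mem_filter, Finset.mem_univ, true_and] at hi
  have h₁ := vecDist_restrict_add B 0 1 i
  have h₂ := vecDist_restrict_add B 1 1 i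
  have h₃ := vecDist_restrict_self_true_add B 1 i
  have h₄ := vecDist_restrict_self_false B 1 i
  have h₅ := vecWt_restrict_add B 1 i
  have h₆ : vecWt (B i) = 7 := by
    rw [← hseven i true, Fintype.card_subtype]
    rfl
  have h₇ := hwt i.2.2 true
  rw [hseven] at h₃
  omega

/-- there is no `14 × 15` binary 3-covering array; equivalently every
`m × 15` binary 3-covering array has `m ≥ 15`, i.e. `CAN(3,15,2) ≥ 15`. -/
theorem no_14_by_15 :
    (∀ C : Fin 14 → Fin 15 → Fin 2, ¬ IsCoveringArray 14 15 2 3 C) ∧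
    (∀ (m : ℕ) (C : Fin m → Fin 15 → Fin 2), IsCoveringArray m 15 2 3 C → 15 ≤ m) := by
  have main : ∀ (m : ℕ) (C : Fin m → Fin 15 → Fin 2), IsCoveringArray m 15 2 3 C → 15 ≤ m := by
    intro m C hC
    refine fifteen_le_of_covering (fun i r => decide (C r i = 1))
      fun c i j hci hcj hij a b b' => ?_
    have hval : ∀ (b : Bool) (u : Fin 2), u = (if b then 1 else 0) → decide (u = 1) = b := by
      decide
    obtain ⟨r, hr⟩ := hC ![c, i, j]
      (by
        intro k l hkl
        fin_cases k <;> fin_cases l <;> simp_all)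
      ![if a then 1 else 0, if b then 1 else 0, if b' then 1 else 0]
    exact ⟨⟨r, hval _ _ (hr 0)⟩, hval _ _ (hr 1), hval _ _ (hr 2)⟩
  exact ⟨fun C hC => absurd (main 14 C hC) (by norm_num), main⟩
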